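/- Let E be a topological graph such that r is a local homeomorphism and r(E¹) is closed in E⁰, and let (ψ, π) be a Toeplitz representation of E in a C*-algebra B. Then (ψ, π) is covariant if and only if there exists a collection 𝒢 ⊆ C_c(E⁰_rg) of nonnegative functions generating C₀(E⁰_rg) as a C*-algebra such that for each f ∈ 𝒢 there exists an open local r-fibration (𝒰, V) with supp(f) ⊆ V and π(f) = Σ_{U∈𝒰} ψ(√(r*_U f)) ψ(√(r*_U f))*. Moreover, if (ψ, π) is covariant, then this identity holds for every nonnegative f ∈ C_c(E⁰_rg) and every open local r-fibration (𝒰, V) with supp(f) ⊆ V. -/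

import Mathlib

open scoped ZeroAtInfty CompactlySupported ComplexOrder

noncomputable section

namespace TopGraphPaper

variable {V G : Type*} [TopologicalSpace V] [TopologicalSpace G]

/-- The set `E⁰_fin` of vertices having a neighbourhood `N` with `r⁻¹(N)` compact. -/
def Efin (r : G → V) : Set V := {v | ∃ N ∈ nhds v, IsCompact (r ⁻¹' N)}

/-- The set `E⁰_sce = E⁰ \ closure (r(E¹))`. -/
def Esce (r : G → V) : Set V := (closure (Set.range r))ᶜ

/-- The set `E⁰_rg = E⁰_fin \ closure (E⁰_sce)`. -/
def Erg (r : G → V) : Set V := Efin r \ closure (Esce r)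

/-- `U ⊆ E¹` is an `s`-section if `s` restricted to `U` is a homeomorphism onto its image. -/
def IsSSection (s : G → V) (U : Set G) : Prop := Topology.IsEmbedding (U.restrict s)

/-- A complex-valued function is nonnegative if all its values are nonnegative reals. -/
def NonnegFn {α : Type*} (x : α → ℂ) : Prop := ∀ a, 0 ≤ x a

/-- The norm `‖x‖_{C₀(E⁰)} = sup_v √(Σ_{s e = v} |x e|²)` on `C_c(E¹)`. -/
def gnorm (s : G → V) (x : G → ℂ) : ℝ :=
  ⨆ v : V, Real.sqrt (∑' e : (s ⁻¹' {v} : Set G), ‖x (e : G)‖ ^ 2)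

variable {B : Type*} [NonUnitalCStarAlgebra B]

/-- A Toeplitz representation of the topological graph `(V, G, r, s)` in the C*-algebra `B`. -/
structure IsToeplitzRep (r s : G → V) (ψ : C_c(G, ℂ) →ₗ[ℂ] B)
    (π : C₀(V, ℂ) →⋆ₙₐ[ℂ] B) : Prop where
  act : ∀ (f : C₀(V, ℂ)) (x y : C_c(G, ℂ)), (∀ e, y e = f (r e) * x e) → ψ y = π f * ψ x
  inner : ∀ (x : C_c(G, ℂ)) (U : Set G), IsOpen U → IsSSection s U → tsupport ⇑x ⊆ U →
    ∀ g : C₀(V, ℂ), (∀ e, x e ≠ 0 → g (s e) = (‖x e‖ : ℂ) ^ 2) →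
      (∀ v, v ∉ s '' Function.support ⇑x → g v = 0) → π g = star (ψ x) * ψ x
  orth : ∀ (x y : C_c(G, ℂ)) (Ux Uy : Set G), IsOpen Ux → IsOpen Uy →
    IsSSection s Ux → IsSSection s Uy → Disjoint Ux Uy →
    tsupport ⇑x ⊆ Ux → tsupport ⇑y ⊆ Uy → star (ψ x) * ψ y = 0

/-- Covariance of a Toeplitz representation.  Here, for each `f` in the generating family `𝒢`,
the function `gN N` plays the role of `√(f_N)`, so that `f_N = (gN N)^2`. -/
def IsCovariant (r s : G → V) (ψ : C_c(G, ℂ) →ₗ[ℂ] B) (π : C₀(V, ℂ) →⋆ₙₐ[ℂ] B) : Prop :=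
  ∃ 𝒢 : Set C₀(V, ℂ),
    (∀ f ∈ 𝒢, HasCompactSupport ⇑f ∧ NonnegFn ⇑f ∧ tsupport ⇑f ⊆ Erg r) ∧
    closure ((NonUnitalStarAlgebra.adjoin ℂ 𝒢 : NonUnitalStarSubalgebra ℂ C₀(V, ℂ)) :
        Set C₀(V, ℂ)) = {f : C₀(V, ℂ) | ∀ v ∉ Erg r, f v = 0} ∧
    ∀ f ∈ 𝒢, ∃ (𝒩 : Finset (Set G)) (gN : Set G → C_c(G, ℂ)),
      (∀ N ∈ 𝒩, IsOpen N ∧ IsSSection s N) ∧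
      r ⁻¹' tsupport ⇑f ⊆ ⋃ N ∈ 𝒩, N ∧
      (∀ N ∈ 𝒩, NonnegFn ⇑(gN N) ∧
        Function.support ⇑(gN N) ⊆ N ∩ r ⁻¹' tsupport ⇑f) ∧
      (∀ e, ∑ N ∈ 𝒩, (gN N e) ^ 2 = f (r e)) ∧
      π f = ∑ N ∈ 𝒩, ψ (gN N) * star (ψ (gN N))

/-- A local `r`-fibration `(𝒰, W)`. -/
structure IsLocalRFib (r s : G → V) (𝒰 : Finset (Set G)) (W : Set V) : Prop where
  disj : (𝒰 : Set (Set G)).Pairwise Disjoint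
  sSec : ∀ U ∈ 𝒰, IsSSection s U
  rSec : ∀ U ∈ 𝒰, IsSSection r U
  pre : r ⁻¹' W = ⋃ U ∈ 𝒰, U
  ran : ∀ U ∈ 𝒰, r '' U = W

/-- An open local `r`-fibration. -/
def IsOpenLocalRFib (r s : G → V) (𝒰 : Finset (Set G)) (W : Set V) : Prop :=
  IsLocalRFib r s 𝒰 W ∧ IsOpen W ∧ ∀ U ∈ 𝒰, IsOpen U

/-- A precompact local `r`-fibration. -/
def IsPrecompactLocalRFib (r s : G → V) (𝒰 : Finset (Set G)) (W : Set V) : Prop :=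
  IsLocalRFib r s 𝒰 W ∧ IsCompact (closure W) ∧ ∀ U ∈ 𝒰, IsCompact (closure U)


variable {V G : Type*} [TopologicalSpace V] [TopologicalSpace G]

/-- The space `Eⁿ` of paths of length `n`, as a subset of `(E¹)ⁿ`. -/
def PathSet (r s : G → V) (n : ℕ) : Set (Fin n → G) :=
  {μ | ∀ (i : ℕ) (h : i + 1 < n), s (μ ⟨i, by omega⟩) = r (μ ⟨i + 1, h⟩)}

/-- The function `x₁ ◇ ⋯ ◇ xₙ` on `(E¹)ⁿ`. -/
def diam {n : ℕ} (x : Fin n → C_c(G, ℂ)) (μ : Fin n → G) : ℂ := ∏ i, x i (μ i)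

/-- `lprod a [b₁,…,bₖ] = a * b₁ * ⋯ * bₖ` (products in a possibly non-unital ring). -/
def lprod {M : Type*} [Mul M] : M → List M → M
  | a, [] => a
  | a, b :: l => lprod (a * b) l

/-- The product `F 0 * F 1 * ⋯ * F (n-1)` for `n ≥ 1`. -/
def finProd {M : Type*} [Mul M] {n : ℕ} (hn : 0 < n) (F : Fin n → M) : M :=
  lprod (F ⟨0, hn⟩) (List.ofFn fun i : Fin (n - 1) => F ⟨(i : ℕ) + 1, by omega⟩)

/-- The infinite path space `E^∞`. -/
def InfPath (r s : G → V) : Type _ := {z : ℕ → G // ∀ i, s (z i) = r (z (i + 1))}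

instance (r s : G → V) : TopologicalSpace (InfPath r s) :=
  inferInstanceAs (TopologicalSpace {z : ℕ → G // ∀ i, s (z i) = r (z (i + 1))})

/-- The shift map `σ : E^∞ → E^∞`. -/
def shift (r s : G → V) : InfPath r s → InfPath r s :=
  fun z => ⟨fun i => z.1 (i + 1), fun i => z.2 (i + 1)⟩

/-- A list of edges is a (finite) path when consecutive edges compose. -/
def IsPathL (r s : G → V) (μ : List G) : Prop := μ.Chain' fun e f => s e = r f

/-- The cylinder set `Z(μ)` of a finite path `μ` of positive length. -/
def cylP (r s : G → V) (μ : List G) : Set (InfPath r s) :=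
  {z | ∀ (i : ℕ) (h : i < μ.length), z.1 i = μ.get ⟨i, h⟩}

/-- The cylinder set `Z(v)` of a vertex `v`. -/
def cylV (r s : G → V) (v : V) : Set (InfPath r s) := {z | r (z.1 0) = v}

/-- `t_μ`, with the convention `t_v = q_v` for paths `μ` of length zero based at `v`. -/
def tPath {M : Type*} [Mul M] (Q : V → M) (T : G → M) (v : V) : List G → M
  | [] => Q v
  | e :: l => lprod (T e) (l.map T)

variable {B : Type*} [NonUnitalCStarAlgebra B]

/-- A Cuntz–Krieger `E`-family in `B`. -/
structure IsCKFamily (r s : G → V) (Q : V → B) (T : G → B) : Prop where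
  proj : ∀ v, star (Q v) = Q v ∧ Q v * Q v = Q v
  orth : ∀ v w, v ≠ w → Q v * Q w = 0
  srce : ∀ e, star (T e) * T e = Q (s e)
  ck : ∀ (v : V) (F : Finset G), (∀ e, e ∈ F ↔ r e = v) → Q v = ∑ e ∈ F, T e * star (T e)


/-- A function continuous on an open set and vanishing off a closed subset of it is continuous. -/
theorem continuous_of_continuousOn_of_zero {X : Type*} [TopologicalSpace X] {f : X → ℂ}
    {U C : Set X} (hU : IsOpen U) (hC : IsClosed C) (hCU : C ⊆ U) (hf : ContinuousOn f U)
    (h0 : ∀ x ∉ C, f x = 0) : Continuous f := by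
  rw [continuous_iff_continuousAt]
  intro x
  by_cases hx : x ∈ C
  · exact hf.continuousAt (hU.mem_nhds (hCU hx))
  · have : f =ᶠ[nhds x] fun _ => 0 := by
      filter_upwards [hC.isOpen_compl.mem_nhds hx] with y hy using h0 y hy
    exact continuousAt_const.congr this.symm

/-- A continuous function vanishing off a compact set, as an element of `C₀`. -/
theorem exists_zeroAtInfty {X : Type*} [TopologicalSpace X] [T2Space X] {f : X → ℂ} {C : Set X}
    (hf : Continuous f) (hC : IsCompact C) (h0 : ∀ x ∉ C, f x = 0) :
    ∃ g : C₀(X, ℂ), ∀ x, g x = f x :=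
  ⟨⟨⟨f, hf⟩, (HasCompactSupport.intro hC h0).is_zero_at_infty⟩, fun _ => rfl⟩

theorem tsupport_subset_of_zero {X : Type*} [TopologicalSpace X] {f : X → ℂ}
    {C : Set X} (hC : IsClosed C) (h0 : ∀ x ∉ C, f x = 0) : tsupport f ⊆ C :=
  closure_minimal (fun x hx => by_contra fun h => hx (h0 x h)) hC

theorem IsSSection.injOn {s : G → V} {U : Set G} (h : IsSSection s U) : Set.InjOn s U :=
  Set.injOn_iff_injective.mpr h.injective

theorem IsSSection.mono {s : G → V} {U U' : Set G} (h : IsSSection s U) (hU : U' ⊆ U) :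
    IsSSection s U' :=
  h.comp (Topology.IsEmbedding.inclusion hU)

theorem isOpenEmbedding_restrict_of_isSSection {s : G → V} (hs : IsLocalHomeomorph s) {U : Set G}
    (hU : IsOpen U) (h : IsSSection s U) : Topology.IsOpenEmbedding (U.domRestrict s) :=
  ⟨h, by rw [Set.range_domRestrict]; exact hs.isOpenMap U hU⟩

theorem exists_open_isSSection {s : G → V} (hs : IsLocalHomeomorph s) (e : G) :
    ∃ U : Set G, IsOpen U ∧ e ∈ U ∧ IsSSection s U := by
  obtain ⟨U, hU, h⟩ := isLocalHomeomorph_iff_isOpenEmbedding_restrict.mp hs e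
  exact ⟨interior U, isOpen_interior, mem_interior_iff_mem_nhds.mpr hU,
    IsSSection.mono h.isEmbedding interior_subset⟩

/-- Transporting a function supported in an open `s`-section along `s`. -/
theorem exists_pushforward [T2Space V] {s : G → V} (hs : IsLocalHomeomorph s) {U : Set G}
    (hU : IsOpen U) (h : IsSSection s U) {y : G → ℂ} {C : Set G} (hy : Continuous y)
    (hC : IsCompact C) (hCU : C ⊆ U) (h0 : ∀ e ∉ C, y e = 0) :
    ∃ g : C₀(V, ℂ), (∀ e ∈ U, g (s e) = y e) ∧ ∀ v ∉ s '' U, g v = 0 := by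
  have hemb := isOpenEmbedding_restrict_of_isSSection hs hU h
  set g : V → ℂ := Function.extend (U.domRestrict s) (fun u => y u) 0 with hg
  have hgU : ∀ e ∈ U, g (s e) = y e := fun e he =>
    hemb.injective.extend_apply (fun u : U => y u) 0 ⟨e, he⟩
  have hgn : ∀ v ∉ s '' U, g v = 0 := fun v hv =>
    Function.extend_apply' _ _ _ fun ⟨u, hu⟩ => hv ⟨u, u.2, hu⟩
  have hgC : ∀ v ∉ s '' C, g v = 0 := by
    intro v hv
    by_cases hvU : v ∈ s '' U
    · obtain ⟨e, he, rfl⟩ := hvU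
      rw [hgU e he]
      exact h0 e fun hc => hv ⟨e, hc, rfl⟩
    · exact hgn v hvU
  have hsC : IsCompact (s '' C) := hC.image hs.continuous
  have hgc : Continuous g := by
    refine continuous_of_continuousOn_of_zero (hs.isOpenMap U hU) hsC.isClosed
      (Set.image_mono hCU) ?_ hgC
    rintro _ ⟨e, he, rfl⟩
    refine ContinuousAt.continuousWithinAt ?_
    have hcomp : g ∘ U.domRestrict s = fun u : U => y u := funext fun u => hgU u u.2
    have : ContinuousAt (g ∘ U.domRestrict s) ⟨e, he⟩ := by
      rw [hcomp]; exact (hy.comp continuous_subtype_val).continuousAt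
    exact hemb.continuousAt_iff.mp this
  obtain ⟨k, hk⟩ := exists_zeroAtInfty hgc hsC hgC
  exact ⟨k, fun e he => by rw [hk, hgU e he], fun v hv => by rw [hk, hgn v hv]⟩

/-- Restriction of a continuous function to an open set in which it has compact support. -/
theorem exists_compactlySupported_restrict [T2Space G] {U C : Set G} (hU : IsOpen U)
    (hC : IsCompact C) (hCU : C ⊆ U) {y : G → ℂ} (hy : ContinuousOn y U)
    (h0 : ∀ e ∈ U, e ∉ C → y e = 0) :
    ∃ z : C_c(G, ℂ), (∀ e ∈ U, z e = y e) ∧ (∀ e ∉ U, z e = 0) ∧ tsupport ⇑z ⊆ C := by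
  classical
  have h0' : ∀ e ∉ C, U.indicator y e = 0 := fun e he => by
    by_cases heU : e ∈ U
    · rw [Set.indicator_of_mem heU, h0 e heU he]
    · exact Set.indicator_of_notMem heU _
  have hc : Continuous (U.indicator y) :=
    continuous_of_continuousOn_of_zero hU hC.isClosed hCU
      (hy.congr fun e he => Set.indicator_of_mem he _) h0'
  exact ⟨⟨⟨U.indicator y, hc⟩, HasCompactSupport.intro hC h0'⟩,
    fun e he => Set.indicator_of_mem he _, fun e he => Set.indicator_of_notMem he _,
    tsupport_subset_of_zero hC.isClosed h0'⟩

namespace IsToeplitzRep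

variable {r s : G → V} {ψ : C_c(G, ℂ) →ₗ[ℂ] B} {π : C₀(V, ℂ) →⋆ₙₐ[ℂ] B}

theorem star_mul_self (hT : IsToeplitzRep r s ψ π) {U : Set G} (hU : IsOpen U)
    (hUs : IsSSection s U) {x : C_c(G, ℂ)} (hx : tsupport ⇑x ⊆ U) {a : C₀(V, ℂ)}
    (ha : ∀ e ∈ U, a (s e) = star (x e) * x e) (ha0 : ∀ v ∉ s '' U, a v = 0) :
    star (ψ x) * ψ x = π a := by
  refine (hT.inner x U hU hUs hx a (fun e he => ?_) fun v hv => ?_).symm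
  · rw [ha e (hx (subset_tsupport _ he)), ← Complex.conj_mul']; rfl
  · by_cases hvU : v ∈ s '' U
    · obtain ⟨e, he, rfl⟩ := hvU
      have : x e = 0 := by_contra fun h => hv ⟨e, h, rfl⟩
      rw [ha e he, this, mul_zero]
    · exact ha0 v hvU

/-- The inner product formula for functions supported in a common open `s`-section. -/
theorem star_mul [T2Space V] (hT : IsToeplitzRep r s ψ π) (hs : IsLocalHomeomorph s) {U : Set G}
    (hU : IsOpen U) (hUs : IsSSection s U) {x y : C_c(G, ℂ)} (hx : tsupport ⇑x ⊆ U)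
    (hy : tsupport ⇑y ⊆ U) {a : C₀(V, ℂ)} (ha : ∀ e ∈ U, a (s e) = star (x e) * y e)
    (ha0 : ∀ v ∉ s '' U, a v = 0) : star (ψ x) * ψ y = π a := by
  have key : ∀ c : ℂ, ∃ b : C₀(V, ℂ), star (ψ (y + c • x)) * ψ (y + c • x) = π b ∧
      (∀ e ∈ U, b (s e) = star (y e + c * x e) * (y e + c * x e)) ∧ ∀ v ∉ s '' U, b v = 0 := by
    intro c
    have hz : tsupport ⇑(y + c • x) ⊆ tsupport ⇑x ∪ tsupport ⇑y := by
      refine tsupport_subset_of_zero (isClosed_tsupport _ |>.union (isClosed_tsupport _)) ?_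
      intro e he
      rw [Set.mem_union, not_or] at he
      simp [image_eq_zero_of_notMem_tsupport he.1, image_eq_zero_of_notMem_tsupport he.2]
    obtain ⟨b, hb, hb0⟩ := exists_pushforward hs hU hUs
      (y := fun e => star ((y + c • x) e) * (y + c • x) e) (C := tsupport ⇑(y + c • x))
      ((map_continuous (y + c • x)).star.mul (map_continuous (y + c • x)))
      (y + c • x).hasCompactSupport (hz.trans (Set.union_subset hx hy)) fun e he => by
        rw [image_eq_zero_of_notMem_tsupport he, mul_zero]
    exact ⟨b, hT.star_mul_self hU hUs (hz.trans (Set.union_subset hx hy)) hb hb0,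
      fun e he => by rw [hb e he]; simp, hb0⟩
  obtain ⟨b₁, h₁, e₁, z₁⟩ := key 1
  obtain ⟨b₂, h₂, e₂, z₂⟩ := key Complex.I
  obtain ⟨b₃, h₃, e₃, z₃⟩ := key (-1)
  obtain ⟨b₄, h₄, e₄, z₄⟩ := key (-Complex.I)
  have hsum : (4 : ℂ) • a = b₁ + Complex.I • b₂ - b₃ - Complex.I • b₄ := by
    ext v
    by_cases hv : v ∈ s '' U
    · obtain ⟨e, he, rfl⟩ := hv
      simp only [ZeroAtInftyContinuousMap.smul_apply, ZeroAtInftyContinuousMap.add_apply,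
        ZeroAtInftyContinuousMap.sub_apply, smul_eq_mul, e₁ e he, e₂ e he, e₃ e he, e₄ e he,
        ha e he, star_add, StarMul.star_mul, star_neg, star_one, Complex.star_def, Complex.conj_I]
      linear_combination (2 * starRingEnd ℂ (x e) * y e
        - 2 * starRingEnd ℂ (y e) * x e) * Complex.I_sq
    · simp [ha0 v hv, z₁ v hv, z₂ v hv, z₃ v hv, z₄ v hv]
  have h4 : (4 : ℂ) • (star (ψ x) * ψ y) = (4 : ℂ) • π a := by
    rw [← map_smul π, hsum, map_sub, map_sub, map_add, map_smul, map_smul, ← h₁, ← h₂, ← h₃, ← h₄]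
    simp only [map_add, map_smul, star_add, star_smul, mul_add, add_mul, smul_mul_assoc,
      mul_smul_comm, smul_add, smul_smul, star_neg, star_one, Complex.star_def, Complex.conj_I]
    generalize star (ψ y) * ψ y = p₁
    generalize star (ψ x) * ψ y = p₂
    generalize star (ψ y) * ψ x = p₃
    generalize star (ψ x) * ψ x = p₄
    match_scalars <;> first
      | ring1
      | linear_combination 2 * Complex.I_sq
      | linear_combination -2 * Complex.I_sq
  exact smul_right_injective B (by norm_num : (4 : ℂ) ≠ 0) h4

/-- The right module formula for functions supported in an open `s`-section. -/
theorem mul_map [T2Space V] (hT : IsToeplitzRep r s ψ π) (hs : IsLocalHomeomorph s) {U : Set G}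
    (hU : IsOpen U) (hUs : IsSSection s U) {x y : C_c(G, ℂ)} (hx : tsupport ⇑x ⊆ U)
    (a : C₀(V, ℂ)) (hy : ∀ e, y e = x e * a (s e)) : ψ x * π a = ψ y := by
  have hyU : tsupport ⇑y ⊆ U := by
    refine (tsupport_subset_of_zero (isClosed_tsupport ⇑x) fun e he => ?_).trans hx
    rw [hy, image_eq_zero_of_notMem_tsupport he, zero_mul]
  obtain ⟨q, hq, hq0⟩ := exists_pushforward hs hU hUs
    (y := fun e => star (x e) * x e) (C := tsupport ⇑x)
    ((map_continuous x).star.mul (map_continuous x)) x.hasCompactSupport hx fun e he => by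
      rw [image_eq_zero_of_notMem_tsupport he, mul_zero]
  have hxx : star (ψ x) * ψ x = π q := hT.star_mul hs hU hUs hx hx hq hq0
  have hxy : star (ψ x) * ψ y = π (q * a) := hT.star_mul hs hU hUs hx hyU
    (fun e he => by simp [hq e he, hy]; ring) fun v hv => by simp [hq0 v hv]
  have hyx : star (ψ y) * ψ x = π (star a * q) := hT.star_mul hs hU hUs hyU hx
    (fun e he => by simp [hq e he, hy]; ring) fun v hv => by simp [hq0 v hv]
  have hyy : star (ψ y) * ψ y = π (star a * q * a) := hT.star_mul hs hU hUs hyU hyU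
    (fun e he => by simp [hq e he, hy]; ring) fun v hv => by simp [hq0 v hv]
  rw [← sub_eq_zero, ← CStarRing.star_mul_self_eq_zero_iff]
  have : star (ψ x * π a - ψ y) * (ψ x * π a - ψ y) =
      star (π a) * (star (ψ x) * ψ x) * π a - star (π a) * (star (ψ x) * ψ y)
        - (star (ψ y) * ψ x) * π a + star (ψ y) * ψ y := by
    simp only [star_sub, StarMul.star_mul, sub_mul, mul_sub, mul_assoc]
    abel
  rw [this, hxx, hxy, hyx, hyy]
  simp only [map_mul, map_star, mul_assoc]
  abel

end IsToeplitzRep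

/-- The closed right ideal generated by the range of `ψ`. -/
def rightIdeal (ψ : C_c(G, ℂ) →ₗ[ℂ] B) : Submodule ℂ B :=
  (Submodule.span ℂ {b : B | ∃ x c, b = ψ x * c}).topologicalClosure

theorem mul_mem_rightIdeal_of_range (ψ : C_c(G, ℂ) →ₗ[ℂ] B) (x : C_c(G, ℂ)) (c : B) :
    ψ x * c ∈ rightIdeal ψ :=
  Submodule.le_topologicalClosure _ (Submodule.subset_span ⟨x, c, rfl⟩)

theorem isClosed_rightIdeal (ψ : C_c(G, ℂ) →ₗ[ℂ] B) : IsClosed (rightIdeal ψ : Set B) :=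
  Submodule.isClosed_topologicalClosure _

theorem mul_mem_rightIdeal {ψ : C_c(G, ℂ) →ₗ[ℂ] B} {b : B} (hb : b ∈ rightIdeal ψ) (c : B) :
    b * c ∈ rightIdeal ψ := by
  have : rightIdeal ψ ≤ (rightIdeal ψ).comap (LinearMap.mulRight ℂ c) := by
    refine Submodule.topologicalClosure_minimal _ (Submodule.span_le.mpr ?_)
      ((isClosed_rightIdeal ψ).preimage (continuous_mul_const c))
    rintro _ ⟨x, d, rfl⟩
    change ψ x * d * c ∈ rightIdeal ψ
    rw [mul_assoc]
    exact mul_mem_rightIdeal_of_range ψ x _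
  exact this hb

theorem mul_eq_zero_of_mem_rightIdeal {ψ : C_c(G, ℂ) →ₗ[ℂ] B} {d b : B}
    (hd : ∀ z, d * ψ z = 0) (hb : b ∈ rightIdeal ψ) : d * b = 0 := by
  have : rightIdeal ψ ≤ LinearMap.ker (LinearMap.mulLeft ℂ d) := by
    refine Submodule.topologicalClosure_minimal _ (Submodule.span_le.mpr ?_)
      (isClosed_singleton.preimage (continuous_const_mul d))
    rintro _ ⟨x, c, rfl⟩
    change d * (ψ x * c) = 0
    rw [← mul_assoc, hd, zero_mul]
  exact this hb

theorem star_eq_self_of_nonnegFn {f : C₀(V, ℂ)} (hf : NonnegFn ⇑f) : star f = f := by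
  ext v
  exact Complex.conj_eq_iff_im.mpr (Complex.nonneg_iff.mp (hf v)).2.symm

theorem IsCovariant.map_mem_rightIdeal {r s : G → V} {ψ : C_c(G, ℂ) →ₗ[ℂ] B}
    {π : C₀(V, ℂ) →⋆ₙₐ[ℂ] B} (h : IsCovariant r s ψ π) {f : C₀(V, ℂ)}
    (hf : ∀ v ∉ Erg r, f v = 0) : π f ∈ rightIdeal ψ := by
  obtain ⟨𝒢, h𝒢, hgen, hcov⟩ := h
  have hmem : f ∈ closure ((NonUnitalStarAlgebra.adjoin ℂ 𝒢 :
      NonUnitalStarSubalgebra ℂ C₀(V, ℂ)) : Set C₀(V, ℂ)) := by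
    rw [hgen]; exact hf
  have hcont : Continuous π :=
    AddMonoidHomClass.continuous_of_bound π 1 fun a => by
      simpa using NonUnitalStarAlgHom.norm_apply_le π a
  refine closure_minimal (t := π ⁻¹' rightIdeal ψ) ?_
    ((isClosed_rightIdeal ψ).preimage hcont) hmem
  have key : ∀ a ∈ NonUnitalStarAlgebra.adjoin ℂ 𝒢,
      π a ∈ rightIdeal ψ ∧ π (star a) ∈ rightIdeal ψ := by
    intro a ha
    induction ha using NonUnitalStarAlgebra.adjoin_induction with
    | mem x hx =>
      have : π x ∈ rightIdeal ψ := by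
        obtain ⟨𝒩, gN, -, -, -, -, hx'⟩ := hcov x hx
        rw [hx']
        exact sum_mem fun N _ => mul_mem_rightIdeal_of_range ψ _ _
      exact ⟨this, by rwa [star_eq_self_of_nonnegFn (h𝒢 x hx).2.1]⟩
    | add x y _ _ hx hy =>
      rw [star_add, map_add, map_add]
      exact ⟨add_mem hx.1 hy.1, add_mem hx.2 hy.2⟩
    | zero => simp
    | mul x y _ _ hx hy =>
      rw [StarMul.star_mul, map_mul, map_mul]
      exact ⟨mul_mem_rightIdeal hx.1 _, mul_mem_rightIdeal hy.2 _⟩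
    | smul c x _ hx =>
      rw [star_smul, map_smul, map_smul]
      exact ⟨Submodule.smul_mem _ _ hx.1, Submodule.smul_mem _ _ hx.2⟩
    | star x _ hx => exact ⟨hx.2, by rw [star_star]; exact hx.1⟩
  exact fun a ha => (key a ha).1

/-- A set in an open local `r`-fibration meets the closed fibre over a compact `K ⊆ W` in a
compact set. -/
theorem IsOpenLocalRFib.isCompact_inter {r s : G → V} (hr : IsLocalHomeomorph r)
    {𝒰 : Finset (Set G)} {W : Set V} (h : IsOpenLocalRFib r s 𝒰 W) {U : Set G} (hU : U ∈ 𝒰)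
    {K : Set V} (hK : IsCompact K) (hKW : K ⊆ W) : IsCompact (U ∩ r ⁻¹' K) := by
  have hemb := isOpenEmbedding_restrict_of_isSSection hr (h.2.2 U hU) (h.1.rSec U hU)
  have := hemb.isInducing.isCompact_preimage' hK (by
    rw [Set.range_domRestrict, h.1.ran U hU]; exact hKW)
  have h2 := this.image continuous_subtype_val
  convert h2 using 1
  ext e
  simp [and_comm]

/-- For a covariant representation, `π(f)` is computed by every open local `r`-fibration whose
base contains the support of `f`. -/
theorem IsToeplitzRep.map_eq_sum_of_isOpenLocalRFib [LocallyCompactSpace V] [T2Space V] [T2Space G]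
    {r s : G → V} (hr : IsLocalHomeomorph r) (hs : IsLocalHomeomorph s)
    {ψ : C_c(G, ℂ) →ₗ[ℂ] B} {π : C₀(V, ℂ) →⋆ₙₐ[ℂ] B} (hT : IsToeplitzRep r s ψ π)
    (hcov : IsCovariant r s ψ π) {f : C₀(V, ℂ)} (hfc : HasCompactSupport ⇑f)
    (hf0 : NonnegFn ⇑f) (hfr : tsupport ⇑f ⊆ Erg r) {𝒰 : Finset (Set G)} {W : Set V}
    (hW : IsOpenLocalRFib r s 𝒰 W) (hfW : tsupport ⇑f ⊆ W) {g : Set G → C_c(G, ℂ)}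
    (hg : ∀ U ∈ 𝒰, NonnegFn ⇑(g U) ∧ (∀ e ∈ U, (g U e) ^ 2 = f (r e)) ∧ ∀ e ∉ U, g U e = 0) :
    π f = ∑ U ∈ 𝒰, ψ (g U) * star (ψ (g U)) := by
  have hgU : ∀ U ∈ 𝒰, tsupport ⇑(g U) ⊆ U ∩ r ⁻¹' tsupport ⇑f := by
    intro U hU
    refine tsupport_subset_of_zero (hW.isCompact_inter hr hU hfc hfW).isClosed fun e he => ?_
    by_cases heU : e ∈ U
    · have : f (r e) = 0 := image_eq_zero_of_notMem_tsupport fun h => he ⟨heU, h⟩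
      exact pow_eq_zero_iff two_ne_zero |>.mp (((hg U hU).2.1 e heU).trans this)
    · exact (hg U hU).2.2 e heU
  obtain ⟨L, hLc, hfL, hLW⟩ := exists_compact_between hfc hW.2.1 hfW
  obtain ⟨κ, hκ1, hκ0, -, -⟩ := exists_continuous_one_zero_of_isCompact hfc
    (isOpen_interior (s := L)).isClosed_compl (Set.disjoint_compl_right_iff_subset.mpr hfL)
  obtain ⟨k, hk⟩ := exists_zeroAtInfty (f := fun v => ((κ v : ℝ) : ℂ))
    (Complex.continuous_ofReal.comp κ.continuous) hLc fun v hv => by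
      have : κ v = 0 := hκ0 fun h => hv (interior_subset h)
      simp [this]
  have hk1 : ∀ v ∈ tsupport ⇑f, k v = 1 := fun v hv => by
    rw [hk, show κ v = 1 from hκ1 hv, Complex.ofReal_one]
  have hkL : ∀ v ∉ L, k v = 0 := fun v hv => by
    rw [hk, show κ v = 0 from hκ0 fun h => hv (interior_subset h), Complex.ofReal_zero]
  have hkstar : star k = k := by
    ext v
    simp [hk]
  have hfk : f = f * k := by
    ext v
    by_cases hv : v ∈ tsupport ⇑f
    · simp [hk1 v hv]
    · simp [image_eq_zero_of_notMem_tsupport hv]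
  have hgk : ∀ U ∈ 𝒰, ψ (g U) = π k * ψ (g U) := fun U hU => hT.act k (g U) (g U) fun e => by
    by_cases he : e ∈ tsupport ⇑(g U)
    · rw [hk1 _ (hgU U hU he).2, one_mul]
    · rw [image_eq_zero_of_notMem_tsupport he, mul_zero]
  set T : B := ∑ U ∈ 𝒰, ψ (g U) * star (ψ (g U)) with hTdef
  have hTk : T = T * π k := by
    rw [hTdef, Finset.sum_mul]
    refine Finset.sum_congr rfl fun U hU => ?_
    have : star (ψ (g U)) = star (ψ (g U)) * π k := by
      conv_lhs => rw [hgk U hU, StarMul.star_mul, ← map_star π k, hkstar]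
    rw [mul_assoc, ← this]
  have hsup : ∀ U ∈ 𝒰, ∀ z : C_c(G, ℂ), tsupport ⇑z ⊆ U → (π f - T) * ψ z = 0 := by
    intro U hU z hz
    have hUo := hW.2.2 U hU
    have hUs := hW.1.sSec U hU
    have hgU' := (hgU U hU).trans Set.inter_subset_left
    rw [sub_mul, sub_eq_zero, hTdef, Finset.sum_mul, Finset.sum_eq_single U]
    · obtain ⟨a, ha, ha0⟩ := exists_pushforward hs hUo hUs
        (y := fun e => star (g U e) * z e) (C := tsupport ⇑z)
        ((map_continuous (g U)).star.mul (map_continuous z)) z.hasCompactSupport hz fun e he => by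
          rw [image_eq_zero_of_notMem_tsupport he, mul_zero]
      obtain ⟨y, hy⟩ : ∃ y : C_c(G, ℂ), ∀ e, y e = f (r e) * z e :=
        ⟨⟨⟨fun e => f (r e) * z e,
          ((map_continuous f).comp hr.continuous).mul (map_continuous z)⟩,
          z.hasCompactSupport.mul_left⟩, fun _ => rfl⟩
      rw [mul_assoc, hT.star_mul hs hUo hUs hgU' hz ha ha0, ← hT.act f z y hy]
      refine (hT.mul_map hs hUo hUs hgU' a fun e => ?_).symm
      rw [hy]
      by_cases he : e ∈ U
      · have hreal : star (g U e) = g U e :=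
          Complex.conj_eq_iff_im.mpr (Complex.nonneg_iff.mp ((hg U hU).1 e)).2.symm
        rw [ha e he, hreal, ← (hg U hU).2.1 e he]
        ring
      · rw [image_eq_zero_of_notMem_tsupport fun h => he (hz h), (hg U hU).2.2 e he]
        ring
    · intro U' hU' hne
      rw [mul_assoc, hT.orth (g U') z U' U (hW.2.2 U' hU') hUo (hW.1.sSec U' hU') hUs
        (hW.1.disj hU' hU hne) ((hgU U' hU').trans Set.inter_subset_left) hz, mul_zero]
    · exact fun h => absurd hU h
  have hzero : ∀ z, (π f - T) * ψ z = 0 := by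
    intro z
    have hex : ∀ U ∈ 𝒰, ∃ y : C_c(G, ℂ), (∀ e ∈ U, y e = k (r e) * z e) ∧ (∀ e ∉ U, y e = 0) ∧
        tsupport ⇑y ⊆ U := by
      intro U hU
      obtain ⟨y, h1, h2, h3⟩ := exists_compactlySupported_restrict (hW.2.2 U hU)
        (hW.isCompact_inter hr hU hLc hLW) Set.inter_subset_left
        (y := fun e => k (r e) * z e)
        (((map_continuous k).comp hr.continuous).mul (map_continuous z)).continuousOn
        fun e he heL => by
          have : k (r e) = 0 := hkL _ fun h => heL ⟨he, h⟩
          simp [this]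
      exact ⟨y, h1, h2, h3.trans Set.inter_subset_left⟩
    choose! y hy1 hy2 hy3 using hex
    have hψ : ψ (∑ U ∈ 𝒰, y U) = π k * ψ z := hT.act k z _ fun e => by
      rw [CompactlySupportedContinuousMap.sum_apply]
      by_cases he : r e ∈ W
      · have : e ∈ ⋃ U ∈ 𝒰, U := hW.1.pre ▸ he
        simp only [Set.mem_iUnion] at this
        obtain ⟨U, hU, heU⟩ := this
        rw [Finset.sum_eq_single U, hy1 U hU e heU]
        · intro U' hU' hne
          exact hy2 U' hU' e fun h => Set.disjoint_left.mp (hW.1.disj hU' hU hne) h heU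
        · exact fun h => absurd hU h
      · rw [hkL _ fun h => he (hLW h), zero_mul]
        refine Finset.sum_eq_zero fun U hU => hy2 U hU e fun h => he ?_
        rw [← hW.1.ran U hU]
        exact ⟨e, h, rfl⟩
    have : π f - T = (π f - T) * π k := by
      rw [sub_mul, ← hTk, ← map_mul, ← hfk]
    rw [this, mul_assoc, ← hψ, map_sum, Finset.mul_sum]
    exact Finset.sum_eq_zero fun U hU => hsup U hU _ (hy3 U hU)
  have hmem : π f - T ∈ rightIdeal ψ := by
    refine sub_mem (hcov.map_mem_rightIdeal fun v hv =>
      image_eq_zero_of_notMem_tsupport fun h => hv (hfr h)) (sum_mem fun U _ => ?_)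
    exact mul_mem_rightIdeal_of_range ψ _ _
  have hself : star (π f - T) = π f - T := by
    rw [star_sub, ← map_star, star_eq_self_of_nonnegFn hf0, hTdef, star_sum]
    simp [StarMul.star_mul]
  rw [← sub_eq_zero, ← CStarRing.star_mul_self_eq_zero_iff, hself]
  exact mul_eq_zero_of_mem_rightIdeal hzero hmem

theorem isOpen_Erg (r : G → V) : IsOpen (Erg r) := by
  refine IsOpen.sdiff (isOpen_iff_mem_nhds.mpr ?_) isClosed_closure
  rintro v ⟨N, hN, hc⟩
  filter_upwards [interior_mem_nhds.mpr hN] with w hw using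
    ⟨N, mem_interior_iff_mem_nhds.mp hw, hc⟩

/-- Every vertex in `E⁰_fin` has a neighbourhood that is the base of an open local
`r`-fibration. -/
theorem exists_isOpenLocalRFib [T2Space V] [T2Space G] {r s : G → V} (hr : IsLocalHomeomorph r)
    (hs : IsLocalHomeomorph s) {v : V} (hv : v ∈ Efin r) :
    ∃ (𝒰 : Finset (Set G)) (W : Set V), IsOpenLocalRFib r s 𝒰 W ∧ v ∈ W := by
  classical
  obtain ⟨N, hN, hNc⟩ := hv
  have hcomp : IsCompact (r ⁻¹' {v}) :=
    hNc.of_isClosed_subset (isClosed_singleton.preimage hr.continuous)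
      (Set.preimage_mono (Set.singleton_subset_iff.mpr (mem_of_mem_nhds hN)))
  have hfin : (r ⁻¹' {v}).Finite := by
    refine hcomp.finite (IsLocalHomeomorphOn.isDiscrete_of_image (f := r)
      (hr.isLocalHomeomorphOn.mono (Set.subset_univ _)) ?_)
    exact (Set.subsingleton_singleton.anti (Set.image_preimage_subset r {v})).isDiscrete
  obtain ⟨A, hA, hAd⟩ := hfin.t2_separation
  choose P hPo hPm hPs using exists_open_isSSection (s := r) hr
  choose Q hQo hQm hQs using exists_open_isSSection hs
  set M : G → Set G := fun e => A e ∩ P e ∩ Q e with hM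
  have hMo : ∀ e, IsOpen (M e) := fun e => ((hA e).2.inter (hPo e)).inter (hQo e)
  have hMm : ∀ e, e ∈ M e := fun e => ⟨⟨(hA e).1, hPm e⟩, hQm e⟩
  set C : Set G := r ⁻¹' N \ ⋃ e ∈ hfin.toFinset, M e with hC
  have hCc : IsCompact C := hNc.diff (isOpen_biUnion fun e _ => hMo e)
  set W : Set V := interior N ∩ (r '' C)ᶜ ∩ ⋂ e ∈ hfin.toFinset, r '' M e with hW
  have hWo : IsOpen W := (isOpen_interior.inter (hCc.image hr.continuous).isClosed.isOpen_compl).inter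
    (isOpen_biInter_finset fun e _ => hr.isOpenMap _ (hMo e))
  have hvW : v ∈ W := by
    refine ⟨⟨mem_interior_iff_mem_nhds.mpr hN, ?_⟩, ?_⟩
    · rintro ⟨e, ⟨-, he⟩, rfl⟩
      exact he (Set.mem_biUnion (hfin.mem_toFinset.mpr rfl) (hMm e))
    · simp only [Set.mem_iInter]
      exact fun e he => ⟨e, hMm e, hfin.mem_toFinset.mp he⟩
  refine ⟨hfin.toFinset.image fun e => M e ∩ r ⁻¹' W, W, ⟨⟨?_, ?_, ?_, ?_, ?_⟩, hWo, ?_⟩, hvW⟩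
  · intro U hU U' hU' hne
    simp only [Finset.coe_image, Set.mem_image, Finset.mem_coe, hfin.mem_toFinset] at hU hU'
    obtain ⟨e, he, rfl⟩ := hU
    obtain ⟨e', he', rfl⟩ := hU'
    have hee : e ≠ e' := by rintro rfl; exact hne rfl
    exact (hAd he he' hee).mono (fun x hx => hx.1.1.1) fun x hx => hx.1.1.1
  · intro U hU
    obtain ⟨e, -, rfl⟩ := Finset.mem_image.mp hU
    exact (hQs e).mono fun x hx => hx.1.2
  · intro U hU
    obtain ⟨e, -, rfl⟩ := Finset.mem_image.mp hU
    exact (hPs e).mono fun x hx => hx.1.1.2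
  · ext x
    simp only [Finset.mem_image, Set.mem_iUnion, exists_prop]
    constructor
    · intro hx
      have hxM : x ∈ ⋃ e ∈ hfin.toFinset, M e := by
        by_contra h
        exact hx.1.2 ⟨x, ⟨Set.mem_preimage.mpr (interior_subset hx.1.1), h⟩, rfl⟩
      simp only [Set.mem_iUnion, exists_prop] at hxM
      obtain ⟨e, he, hxe⟩ := hxM
      exact ⟨_, ⟨e, he, rfl⟩, hxe, hx⟩
    · rintro ⟨_, ⟨e, -, rfl⟩, hx⟩
      exact hx.2
  · intro U hU
    obtain ⟨e, he, rfl⟩ := Finset.mem_image.mp hU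
    rw [Set.image_inter_preimage]
    refine Set.inter_eq_right.mpr fun w hw => ?_
    exact Set.mem_iInter₂.mp hw.2 e he
  · intro U hU
    obtain ⟨e, -, rfl⟩ := Finset.mem_image.mp hU
    exact (hMo e).inter (hWo.preimage hr.continuous)

/-- Nonnegative compactly supported functions on `R` whose support lies in a member of a
family of sets. -/
def subordinate (R : Set V) (P : Set V → Prop) : Set C₀(V, ℂ) :=
  {f | HasCompactSupport ⇑f ∧ NonnegFn ⇑f ∧ tsupport ⇑f ⊆ R ∧ ∃ W, P W ∧ tsupport ⇑f ⊆ W}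

theorem mem_adjoin_subordinate [T2Space V] {R : Set V} {P : Set V → Prop} {W C : Set V}
    (hP : P W) (hC : IsCompact C) (hCR : C ⊆ R) (hCW : C ⊆ W) {f : C₀(V, ℂ)}
    (hf : ∀ v ∉ C, f v = 0) : f ∈ NonUnitalStarAlgebra.adjoin ℂ (subordinate R P) := by
  have key : ∀ c : ℂ → ℝ, Continuous c → c 0 = 0 → ∃ h ∈ NonUnitalStarAlgebra.adjoin ℂ
      (subordinate R P), ∀ v, h v = (max (c (f v)) 0 : ℝ) := by
    intro c hc hc0
    have h0 : ∀ v ∉ C, ((max (c (f v)) 0 : ℝ) : ℂ) = 0 := fun v hv => by simp [hf v hv, hc0]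
    obtain ⟨h, hh⟩ := exists_zeroAtInfty (f := fun v => ((max (c (f v)) 0 : ℝ) : ℂ))
      (Complex.continuous_ofReal.comp ((hc.comp (map_continuous f)).max continuous_const)) hC h0
    have hsupp : tsupport ⇑h ⊆ C :=
      tsupport_subset_of_zero hC.isClosed fun v hv => by rw [hh, h0 v hv]
    refine ⟨h, NonUnitalStarAlgebra.subset_adjoin ℂ _ ⟨?_, fun v => ?_, hsupp.trans hCR, W, hP,
      hsupp.trans hCW⟩, hh⟩
    · exact hC.of_isClosed_subset (isClosed_tsupport _) hsupp
    · rw [hh]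
      exact Complex.zero_le_real.mpr (le_max_right _ _)
  obtain ⟨h₁, m₁, e₁⟩ := key Complex.re Complex.continuous_re rfl
  obtain ⟨h₂, m₂, e₂⟩ := key (fun z => -z.re) Complex.continuous_re.neg (by simp)
  obtain ⟨h₃, m₃, e₃⟩ := key Complex.im Complex.continuous_im rfl
  obtain ⟨h₄, m₄, e₄⟩ := key (fun z => -z.im) Complex.continuous_im.neg (by simp)
  have hsum : f = h₁ - h₂ + Complex.I • (h₃ - h₄) := by
    have hmax : ∀ x : ℝ, max x 0 - max (-x) 0 = x := fun x => by
      rcases le_total 0 x with h | h <;> simp [h]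
    ext v
    simp only [ZeroAtInftyContinuousMap.smul_apply, ZeroAtInftyContinuousMap.add_apply,
        ZeroAtInftyContinuousMap.sub_apply, smul_eq_mul, e₁, e₂, e₃, e₄]
    rw [← Complex.ofReal_sub, ← Complex.ofReal_sub, hmax, hmax, mul_comm, Complex.re_add_im]
  rw [hsum]
  exact add_mem (sub_mem m₁ m₂) (SMulMemClass.smul_mem _ (sub_mem m₃ m₄))

/-- Functions supported in members of an open cover of `R` generate `C₀(R)`. -/
theorem closure_adjoin_subordinate [LocallyCompactSpace V] [T2Space V] {R : Set V}
    (hR : IsOpen R) {P : Set V → Prop} (hP : ∀ v ∈ R, ∃ W, IsOpen W ∧ v ∈ W ∧ P W) :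
    closure ((NonUnitalStarAlgebra.adjoin ℂ (subordinate R P) :
      NonUnitalStarSubalgebra ℂ C₀(V, ℂ)) : Set C₀(V, ℂ)) = {f | ∀ v ∉ R, f v = 0} := by
  have hev : ∀ v : V, Continuous fun f : C₀(V, ℂ) => f v := fun v =>
    (BoundedContinuousFunction.lipschitz_eval_const v).continuous.comp
      (ZeroAtInftyContinuousMap.isometry_toBCF (α := V) (β := ℂ)).continuous
  apply subset_antisymm
  · refine closure_minimal ?_ ?_
    · intro a ha v hv
      induction ha using NonUnitalStarAlgebra.adjoin_induction with
      | mem x hx => exact image_eq_zero_of_notMem_tsupport fun h => hv (hx.2.2.1 h)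
      | add x y _ _ hx hy => simp [hx, hy]
      | zero => rfl
      | mul x y _ _ hx hy => simp [hx]
      | smul c x _ hx => simp [hx]
      | star x _ hx => simp [hx]
    · simp only [Set.ofPred_forall]
      exact isClosed_iInter fun v => isClosed_iInter fun _ =>
        isClosed_eq (hev v) continuous_const
  · intro f hf
    rw [Metric.mem_closure_iff]
    intro ε hε
    set K : Set V := {v | ε / 2 ≤ ‖f v‖} with hK
    have hKc : IsCompact K := by
      have h1 : ∀ᶠ v in Filter.cocompact V, ‖f v‖ < ε / 2 := by
        have := (ZeroAtInftyContinuousMapClass.zero_at_infty f).norm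
        rw [norm_zero] at this
        exact this.eventually (gt_mem_nhds (half_pos hε))
      obtain ⟨t, ht, hts⟩ := Filter.mem_cocompact.mp h1
      refine ht.of_isClosed_subset (isClosed_le continuous_const (map_continuous f).norm) ?_
      intro v hv
      by_contra h
      exact absurd (show ‖f v‖ < ε / 2 from hts h) (not_lt.mpr hv)
    have hKR : K ⊆ R := fun v hv => by
      by_contra h
      have : ε / 2 ≤ ‖f v‖ := hv
      rw [hf v h, norm_zero] at this
      linarith
    obtain ⟨L, hLc, hKL, hLR⟩ := exists_compact_between hKc hR hKR
    obtain ⟨χ, hχ1, hχ0, -, hχ⟩ := exists_continuous_one_zero_of_isCompact hKc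
      (isOpen_interior (s := L)).isClosed_compl (Set.disjoint_compl_right_iff_subset.mpr hKL)
    choose! w hwo hwm hwP using hP
    obtain ⟨t, htL, hLt⟩ := hLc.elim_nhds_subcover w
      fun v hv => (hwo v (hLR hv)).mem_nhds (hwm v (hLR hv))
    have hmem : ∀ i : Fin t.card, (t.equivFin.symm i : V) ∈ R := fun i =>
      hLR (htL _ (t.equivFin.symm i).2)
    obtain ⟨ρ, hρs, hρ1, -, hρc⟩ := exists_continuous_sum_one_of_isOpen_isCompact
      (s := fun i : Fin t.card => w (t.equivFin.symm i)) (fun i => hwo _ (hmem i)) hLc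
      fun v hv => by
        obtain ⟨u, hu, hvu⟩ := Set.mem_iUnion₂.mp (hLt hv)
        exact Set.mem_iUnion.mpr ⟨t.equivFin ⟨u, hu⟩, by simpa using hvu⟩
    have hb : ∀ i : Fin t.card, ∃ b ∈ NonUnitalStarAlgebra.adjoin ℂ (subordinate R P),
        ∀ v, b v = (ρ i v : ℂ) * ((χ v : ℂ) * f v) := by
      intro i
      have h0 : ∀ v ∉ tsupport (ρ i) ∩ L, (ρ i v : ℂ) * ((χ v : ℂ) * f v) = 0 := by
        intro v hv
        by_cases hvL : v ∈ L
        · rw [image_eq_zero_of_notMem_tsupport fun h => hv ⟨h, hvL⟩, Complex.ofReal_zero, zero_mul]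
        · rw [show χ v = 0 from hχ0 fun h => hvL (interior_subset h), Complex.ofReal_zero,
            zero_mul, mul_zero]
      have hc : IsCompact (tsupport (ρ i) ∩ L) := hLc.inter_left (isClosed_tsupport _)
      obtain ⟨b, hb⟩ := exists_zeroAtInfty
        (f := fun v => (ρ i v : ℂ) * ((χ v : ℂ) * f v))
        ((Complex.continuous_ofReal.comp (ρ i).continuous).mul
          ((Complex.continuous_ofReal.comp χ.continuous).mul (map_continuous f))) hc h0
      exact ⟨b, mem_adjoin_subordinate (hwP _ (hmem i)) hc (Set.inter_subset_right.trans hLR)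
        (Set.inter_subset_left.trans (hρs i)) fun v hv => by rw [hb, h0 v hv], hb⟩
    choose b hbm hbv using hb
    have hsum : ∀ v, (∑ i, b i) v = (χ v : ℂ) * f v := by
      intro v
      have happ : (∑ i, b i) v = ∑ i, b i v :=
        map_sum (⟨⟨fun g => g v, rfl⟩, fun _ _ => rfl⟩ : C₀(V, ℂ) →+ ℂ) b Finset.univ
      rw [happ]
      simp only [hbv]
      rw [← Finset.sum_mul]
      by_cases hvL : v ∈ L
      · have := hρ1 hvL
        rw [Finset.sum_apply, Pi.one_apply] at this
        rw [← Complex.ofReal_sum, this, Complex.ofReal_one, one_mul]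
      · rw [show χ v = 0 from hχ0 fun h => hvL (interior_subset h), Complex.ofReal_zero,
          zero_mul, mul_zero]
    refine ⟨∑ i, b i, sum_mem fun i _ => hbm i, ?_⟩
    refine lt_of_le_of_lt ?_ (half_lt_self hε)
    rw [← ZeroAtInftyContinuousMap.dist_toBCF_eq_dist,
      BoundedContinuousFunction.dist_le (half_pos hε).le]
    intro v
    change dist (f v) ((∑ i, b i) v) ≤ ε / 2
    rw [hsum, dist_eq_norm]
    by_cases hv : v ∈ K
    · rw [show χ v = 1 from hχ1 hv, Complex.ofReal_one, one_mul, sub_self, norm_zero]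
      exact (half_pos hε).le
    · have hlt : ‖f v‖ < ε / 2 := not_le.mp hv
      have : f v - (χ v : ℂ) * f v = ((1 - χ v : ℝ) : ℂ) * f v := by push_cast; ring
      rw [this, norm_mul, Complex.norm_real, Real.norm_of_nonneg (sub_nonneg.mpr (hχ v).2)]
      refine (mul_le_of_le_one_left (norm_nonneg _) ?_).trans hlt.le
      linarith [(hχ v).1]

/-- The square roots of the pullbacks of `f` along the members of an open local `r`-fibration. -/
theorem IsOpenLocalRFib.exists_sqrt [T2Space G] {r s : G → V} (hr : IsLocalHomeomorph r)
    {𝒰 : Finset (Set G)} {W : Set V} (h : IsOpenLocalRFib r s 𝒰 W) {f : C₀(V, ℂ)}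
    (hfc : HasCompactSupport ⇑f) (hf0 : NonnegFn ⇑f) (hfW : tsupport ⇑f ⊆ W) :
    ∃ g : Set G → C_c(G, ℂ), ∀ U ∈ 𝒰,
      NonnegFn ⇑(g U) ∧ (∀ e ∈ U, (g U e) ^ 2 = f (r e)) ∧ ∀ e ∉ U, g U e = 0 := by
  have key : ∀ U ∈ 𝒰, ∃ g : C_c(G, ℂ),
      NonnegFn ⇑g ∧ (∀ e ∈ U, (g e) ^ 2 = f (r e)) ∧ ∀ e ∉ U, g e = 0 := by
    intro U hU
    obtain ⟨g, hg, hg0, -⟩ := exists_compactlySupported_restrict (h.2.2 U hU)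
      (h.isCompact_inter hr hU hfc hfW) Set.inter_subset_left
      (y := fun e => ((Real.sqrt (f (r e)).re : ℝ) : ℂ))
      (Complex.continuous_ofReal.comp (Real.continuous_sqrt.comp (Complex.continuous_re.comp
        ((map_continuous f).comp hr.continuous)))).continuousOn
      fun e he hn => by
        have : f (r e) = 0 := image_eq_zero_of_notMem_tsupport fun h => hn ⟨he, h⟩
        simp [this]
    refine ⟨g, fun e => ?_, fun e he => ?_, hg0⟩
    · by_cases he : e ∈ U
      · rw [hg e he]
        exact Complex.zero_le_real.mpr (Real.sqrt_nonneg _)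
      · rw [hg0 e he]
    · have hnn := Complex.nonneg_iff.mp (hf0 (r e))
      rw [hg e he, ← Complex.ofReal_pow, Real.sq_sqrt hnn.1]
      exact Complex.ext rfl hnn.2
  choose! g hg using key
  exact ⟨g, hg⟩

/-- Suppose `r` is a local homeomorphism and `r(E¹)` is closed.  A Toeplitz
representation `(ψ, π)` is covariant iff there is a generating family `𝒢` of nonnegative
functions in `C_c(E⁰_rg)` such that for each `f ∈ 𝒢` there is an open local `r`-fibration
`(𝒰, W)` with `supp f ⊆ W` and `π(f) = Σ_{U ∈ 𝒰} ψ(√(r*_U f)) ψ(√(r*_U f))*`.  Moreover, if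
`(ψ, π)` is covariant then this identity holds for every nonnegative `f ∈ C_c(E⁰_rg)` and
every open local `r`-fibration `(𝒰, W)` with `supp f ⊆ W`.  (Here `g U` plays the role of
`√(r*_U f)`.) -/
theorem statement7 {V G : Type*} [TopologicalSpace V] [TopologicalSpace G]
    [LocallyCompactSpace V] [T2Space V] [LocallyCompactSpace G] [T2Space G]
    (r s : G → V) (hr : Continuous r) (hs : IsLocalHomeomorph s)
    (hrlh : IsLocalHomeomorph r) (hclosed : IsClosed (Set.range r))
    {B : Type*} [NonUnitalCStarAlgebra B]
    (ψ : C_c(G, ℂ) →ₗ[ℂ] B) (π : C₀(V, ℂ) →⋆ₙₐ[ℂ] B) (hT : IsToeplitzRep r s ψ π) :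
    (IsCovariant r s ψ π ↔
      ∃ 𝒢 : Set C₀(V, ℂ),
        (∀ f ∈ 𝒢, HasCompactSupport ⇑f ∧ NonnegFn ⇑f ∧ tsupport ⇑f ⊆ Erg r) ∧
        closure ((NonUnitalStarAlgebra.adjoin ℂ 𝒢 : NonUnitalStarSubalgebra ℂ C₀(V, ℂ)) :
            Set C₀(V, ℂ)) = {f : C₀(V, ℂ) | ∀ v ∉ Erg r, f v = 0} ∧
        ∀ f ∈ 𝒢, ∃ (𝒰 : Finset (Set G)) (W : Set V) (g : Set G → C_c(G, ℂ)),
          IsOpenLocalRFib r s 𝒰 W ∧ tsupport ⇑f ⊆ W ∧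
          (∀ U ∈ 𝒰, NonnegFn ⇑(g U) ∧ (∀ e ∈ U, (g U e) ^ 2 = f (r e)) ∧
            ∀ e ∉ U, g U e = 0) ∧
          π f = ∑ U ∈ 𝒰, ψ (g U) * star (ψ (g U))) ∧
    (IsCovariant r s ψ π →
      ∀ f : C₀(V, ℂ), HasCompactSupport ⇑f → NonnegFn ⇑f → tsupport ⇑f ⊆ Erg r →
      ∀ (𝒰 : Finset (Set G)) (W : Set V), IsOpenLocalRFib r s 𝒰 W → tsupport ⇑f ⊆ W →
      ∀ g : Set G → C_c(G, ℂ),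
        (∀ U ∈ 𝒰, NonnegFn ⇑(g U) ∧ (∀ e ∈ U, (g U e) ^ 2 = f (r e)) ∧
          ∀ e ∉ U, g U e = 0) →
        π f = ∑ U ∈ 𝒰, ψ (g U) * star (ψ (g U))) := by
  have hmoreover : IsCovariant r s ψ π →
      ∀ f : C₀(V, ℂ), HasCompactSupport ⇑f → NonnegFn ⇑f → tsupport ⇑f ⊆ Erg r →
      ∀ (𝒰 : Finset (Set G)) (W : Set V), IsOpenLocalRFib r s 𝒰 W → tsupport ⇑f ⊆ W →
      ∀ g : Set G → C_c(G, ℂ),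
        (∀ U ∈ 𝒰, NonnegFn ⇑(g U) ∧ (∀ e ∈ U, (g U e) ^ 2 = f (r e)) ∧
          ∀ e ∉ U, g U e = 0) →
        π f = ∑ U ∈ 𝒰, ψ (g U) * star (ψ (g U)) :=
    fun hcov f hfc hf0 hfr 𝒰 W hW hfW g hg =>
      hT.map_eq_sum_of_isOpenLocalRFib hrlh hs hcov hfc hf0 hfr hW hfW hg
  refine ⟨⟨fun hcov => ?_, ?_⟩, hmoreover⟩
  · refine ⟨subordinate (Erg r) fun W => ∃ 𝒰, IsOpenLocalRFib r s 𝒰 W,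
      fun f hf => ⟨hf.1, hf.2.1, hf.2.2.1⟩, ?_, ?_⟩
    · refine closure_adjoin_subordinate (isOpen_Erg r) fun v hv => ?_
      obtain ⟨𝒰, W, hW, hvW⟩ := exists_isOpenLocalRFib hrlh hs hv.1
      exact ⟨W, hW.2.1, hvW, 𝒰, hW⟩
    · rintro f ⟨hfc, hf0, hfr, W, ⟨𝒰, hW⟩, hfW⟩
      obtain ⟨g, hg⟩ := hW.exists_sqrt hrlh hfc hf0 hfW
      exact ⟨𝒰, W, g, hW, hfW, hg, hmoreover hcov f hfc hf0 hfr 𝒰 W hW hfW g hg⟩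
  · rintro ⟨𝒢, h𝒢, hgen, hfib⟩
    refine ⟨𝒢, h𝒢, hgen, fun f hf => ?_⟩
    obtain ⟨𝒰, W, g, hW, hfW, hg, hπ⟩ := hfib f hf
    refine ⟨𝒰, g, fun U hU => ⟨hW.2.2 U hU, hW.1.sSec U hU⟩, ?_, fun U hU => ⟨(hg U hU).1, ?_⟩,
      fun e => ?_, hπ⟩
    · rw [← hW.1.pre]
      exact Set.preimage_mono hfW
    · intro e he
      have heU : e ∈ U := by_contra fun h => he ((hg U hU).2.2 e h)
      refine ⟨heU, by_contra fun h => he ?_⟩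
      have : f (r e) = 0 := image_eq_zero_of_notMem_tsupport h
      exact pow_eq_zero_iff two_ne_zero |>.mp (((hg U hU).2.1 e heU).trans this)
    · by_cases he : r e ∈ W
      · have : e ∈ ⋃ U ∈ 𝒰, U := hW.1.pre ▸ he
        obtain ⟨U, hU, heU⟩ := Set.mem_iUnion₂.mp this
        rw [Finset.sum_eq_single U, (hg U hU).2.1 e heU]
        · intro U' hU' hne
          rw [(hg U' hU').2.2 e fun h => Set.disjoint_left.mp (hW.1.disj hU' hU hne) h heU]
          simp
        · exact fun h => absurd hU h
      · rw [image_eq_zero_of_notMem_tsupport fun h => he (hfW h)]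
        refine Finset.sum_eq_zero fun U hU => ?_
        rw [(hg U hU).2.2 e fun h => he (hW.1.ran U hU ▸ ⟨e, h, rfl⟩)]
        simp

end TopGraphPaper
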